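/- arXiv:1612.08001 — 2 statements merged into one kernel-verified Lean document; each statement's English description precedes it below -/
import Mathlib

section
/- The following three conditions are equivalent: (a) Ž_i Ž_j = (ȟ_{ij} − 1) ȟ_{ij}^{−1} Ž_j Ž_i for all i < j; (b) the elements ψ̌_i Ž_i, i = 1, …, n, pairwise commute; (c) the elements Ž_i ψ̌'_i, i = 1, …, n, pairwise commute. -/
open Finset

/-- Ordered product of a family of (commuting) ring elements over a finite set of indices. -/
def oprod {A : Type*} [Monoid A] {n : ℕ} (s : Finset (Fin n)) (f : Fin n → A) : A :=
  ((s.sort (· ≤ ·)).map f).prod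

lemma oprod_commute {A : Type*} [Monoid A] {n : ℕ} (s : Finset (Fin n)) (f : Fin n → A) (x : A)
    (hx : ∀ m ∈ s, Commute x (f m)) : Commute x (oprod s f) := by
  unfold oprod
  apply Commute.list_prod_right
  intro y hy
  obtain ⟨m, hm, rfl⟩ := List.mem_map.1 hy
  exact hx m ((Finset.mem_sort _).1 hm)

lemma oprod_isUnit {A : Type*} [Monoid A] {n : ℕ} (s : Finset (Fin n)) (f : Fin n → A)
    (hx : ∀ m ∈ s, IsUnit (f m)) : IsUnit (oprod s f) := by
  unfold oprod
  apply List.prod_isUnit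
  intro y hy
  obtain ⟨m, hm, rfl⟩ := List.mem_map.1 hy
  exact hx m ((Finset.mem_sort _).1 hm)

lemma oprod_split {A : Type*} [Monoid A] {n : ℕ} (s : Finset (Fin n)) (f : Fin n → A)
    (hc : ∀ a b, Commute (f a) (f b)) (j : Fin n) (hj : j ∈ s) :
    oprod s f = f j * oprod (s.erase j) f := by
  unfold oprod
  rw [← List.prod_cons, ← List.map_cons]
  apply List.Perm.prod_eq'
  · apply List.Perm.map
    apply (List.perm_ext_iff_of_nodup (Finset.sort_nodup _ _) _).2
    · intro a
      simp only [Finset.mem_sort, List.mem_cons, Finset.mem_erase]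
      by_cases h : a = j
      · simp [h, hj]
      · simp [h]
    · simp [List.nodup_cons, Finset.sort_nodup]
  · rw [List.pairwise_map]
    exact List.Pairwise.imp (fun _ => hc _ _) (Finset.sort_nodup s (· ≤ ·))

/-- core computation for (b) -/
lemma core_b {A : Type*} [Ring A] (x y p q r u : A)
    (hp : p = u * r) (hr : IsUnit r) (hq : IsUnit q) (hur : Commute u r) (huq : Commute u q)
    (hrq : Commute r q) (hxq : Commute x q) (hyr : Commute y r) (hyu : y * u = (u - 1) * y) :
    (p * x) * (q * y) = (q * y) * (p * x) ↔ u * (x * y) = (u - 1) * (y * x) := by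
  have e1 : (p * x) * (q * y) = (q * r) * (u * (x * y)) := by
    calc (p * x) * (q * y) = u * r * (x * q) * y := by rw [hp]; noncomm_ring
      _ = u * (r * q) * x * y := by rw [hxq.eq]; noncomm_ring
      _ = (u * q) * r * x * y := by rw [hrq.eq]; noncomm_ring
      _ = q * (u * r) * x * y := by rw [huq.eq]; noncomm_ring
      _ = _ := by rw [hur.eq]; noncomm_ring
  have e2 : (q * y) * (p * x) = (q * r) * ((u - 1) * (y * x)) := by
    calc (q * y) * (p * x) = q * y * (u * r) * x := by rw [hp]; noncomm_ring
      _ = q * (y * r) * u * x := by rw [hur.eq]; noncomm_ring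
      _ = q * r * (y * u) * x := by rw [hyr.eq]; noncomm_ring
      _ = _ := by rw [hyu]; simp only [mul_assoc]
  rw [e1, e2]
  exact (hq.mul hr).mul_right_inj

/-- core computation for (c): `p` belongs to `x`, `q = v * r` to `y` -/
lemma core_c {A : Type*} [Ring A] (x y p q r v : A)
    (hq : q = v * r) (hr : IsUnit r) (hp : IsUnit p) (hpv : Commute p v)
    (hrp : Commute r p) (hyp : Commute y p) (hxr : Commute x r) (hvx : v * x = x * (v + 1)) 
    (hv1 : Commute v (x * y)) (hv2 : Commute v (y * x)) :
    (x * p) * (y * q) = (y * q) * (x * p) ↔ (-v) * (x * y) = (-v - 1) * (y * x) := by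
  have e1 : (x * p) * (y * q) = (v * (x * y)) * (r * p) := by
    calc (x * p) * (y * q) = x * (p * y) * v * r := by rw [hq]; noncomm_ring
      _ = x * y * (p * v) * r := by rw [← hyp.eq]; noncomm_ring
      _ = (x * y * v) * (p * r) := by rw [hpv.eq]; noncomm_ring
      _ = _ := by rw [← hrp.eq, ← hv1.eq]
  have e2 : (y * q) * (x * p) = ((v + 1) * (y * x)) * (r * p) := by
    calc (y * q) * (x * p) = y * v * (r * x) * p := by rw [hq]; noncomm_ring
      _ = y * (v * x) * r * p := by rw [← hxr.eq]; noncomm_ring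
      _ = (y * x * v + y * x) * (r * p) := by rw [hvx]; noncomm_ring
      _ = _ := by rw [← hv2.eq]; noncomm_ring
  rw [e1, e2, (hr.mul hp).mul_left_inj, neg_mul, show -v - 1 = -(v + 1) by abel, neg_mul, neg_inj]

/-- Lemma 2.2 (ii) of Herlemont–Ogievetsky: for elements `Ž_1, …, Ž_n` of weight `−ε_i`
with respect to a commuting family `ȟ_1, …, ȟ_n` (with `ȟ_ij = ȟ_i − ȟ_j` invertible for
`i ≠ j`, `ψ̌_i = Π_{k>i} ȟ_ik`, `ψ̌'_i = Π_{k<i} ȟ_ik`), the relations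
`Ž_i Ž_j = (ȟ_ij − 1) ȟ_ij⁻¹ Ž_j Ž_i` for `i < j` hold if and only if the family
`{ψ̌_i Ž_i}` is commutative, if and only if the family `{Ž_i ψ̌'_i}` is commutative. -/
theorem stmt4 {k A : Type*} [Field k] [CharZero k] [Ring A] [Algebra k A]
    {n : ℕ} (hn : 1 ≤ n) (h Z : Fin n → A)
    (hcomm : ∀ i j, h i * h j = h j * h i)
    (hunit : ∀ i j : Fin n, i ≠ j → IsUnit (h i - h j))
    (hhZ : ∀ i j, h i * Z j = Z j * (h i - if i = j then 1 else 0)) :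
    ((∀ i j, i < j →
        Z i * Z j = (h i - h j - 1) * Ring.inverse (h i - h j) * (Z j * Z i)) ↔
      (∀ i j, (oprod (Finset.univ.filter fun m => i < m) (fun m => h i - h m) * Z i) *
              (oprod (Finset.univ.filter fun m => j < m) (fun m => h j - h m) * Z j) =
              (oprod (Finset.univ.filter fun m => j < m) (fun m => h j - h m) * Z j) *
              (oprod (Finset.univ.filter fun m => i < m) (fun m => h i - h m) * Z i))) ∧
    ((∀ i j, i < j →
        Z i * Z j = (h i - h j - 1) * Ring.inverse (h i - h j) * (Z j * Z i)) ↔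
      (∀ i j, (Z i * oprod (Finset.univ.filter fun m => m < i) (fun m => h i - h m)) *
              (Z j * oprod (Finset.univ.filter fun m => m < j) (fun m => h j - h m)) =
              (Z j * oprod (Finset.univ.filter fun m => m < j) (fun m => h j - h m)) *
              (Z i * oprod (Finset.univ.filter fun m => m < i) (fun m => h i - h m)))) := by
  have hdc : ∀ a b c d, Commute (h a - h b) (h c - h d) := by
    intro a b c d
    have hC : ∀ i j, Commute (h i) (h j) := hcomm
    exact ((hC a c).sub_right (hC a d)).sub_left ((hC b c).sub_right (hC b d))
  have hzc : ∀ a i, a ≠ i → Commute (Z i) (h a) := by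
    intro a i hai
    have := hhZ a i
    rw [if_neg hai, sub_zero] at this
    exact this.symm
  have hzd : ∀ a b i, a ≠ i → b ≠ i → Commute (Z i) (h a - h b) := fun a b i ha hb =>
    (hzc a i ha).sub_right (hzc b i hb)
  have hzz : ∀ i, h i * Z i = Z i * h i - Z i := by
    intro i
    have := hhZ i i
    rw [if_pos rfl, mul_sub, mul_one] at this
    exact this
  have hZ' : ∀ i j, i ≠ j → Z j * (h i - h j) = (h i - h j - 1) * Z j := by
    intro i j hij
    rw [sub_mul, sub_mul, mul_sub, hzz j, (hzc i j hij).eq, one_mul]; abel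
  have hZ2 : ∀ i j, i ≠ j → (h j - h i) * Z i = Z i * (h j - h i + 1) := by
    intro i j hij
    rw [sub_mul, mul_add, mul_sub, hzz i, (hzc j i hij.symm).eq, mul_one]; abel
  have hinv : ∀ i j, i < j →
      (Z i * Z j = (h i - h j - 1) * Ring.inverse (h i - h j) * (Z j * Z i) ↔
        (h i - h j) * (Z i * Z j) = (h i - h j - 1) * (Z j * Z i)) := by
    intro i j hij
    have hu := hunit i j hij.ne
    rw [← hu.mul_right_inj (b := Z i * Z j)]
    have : (h i - h j) * ((h i - h j - 1) * Ring.inverse (h i - h j) * (Z j * Z i))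
        = (h i - h j - 1) * (Z j * Z i) := by
      have hc : (h i - h j) * (h i - h j - 1) = (h i - h j - 1) * (h i - h j) := by noncomm_ring
      rw [← mul_assoc (h i - h j), ← mul_assoc (h i - h j), hc, mul_assoc (h i - h j - 1), Ring.mul_inverse_cancel _ hu,
        mul_one]
    rw [this]
  have hv : ∀ i j, i ≠ j → Commute (h j - h i) (Z i * Z j) := by
    intro i j hij
    have h1 := hZ2 i j hij
    have h2 := hZ' i j hij
    have h3 : (h j - h i + 1) * Z j = Z j * (h j - h i) := by
      rw [← neg_sub (h i) (h j), mul_neg, h2]; noncomm_ring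
    show _ * _ = _ * _
    rw [← mul_assoc, h1, mul_assoc, h3, mul_assoc]
  have hb : ∀ i j, i < j →
      (Z i * Z j = (h i - h j - 1) * Ring.inverse (h i - h j) * (Z j * Z i) ↔
       (oprod (Finset.univ.filter fun m => i < m) (fun m => h i - h m) * Z i) *
              (oprod (Finset.univ.filter fun m => j < m) (fun m => h j - h m) * Z j) =
              (oprod (Finset.univ.filter fun m => j < m) (fun m => h j - h m) * Z j) *
              (oprod (Finset.univ.filter fun m => i < m) (fun m => h i - h m) * Z i)) := by
    intro i j hij
    rw [hinv i j hij]
    symm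
    apply core_b (hp := oprod_split (Finset.univ.filter fun m => i < m) (fun m => h i - h m) (fun a b => hdc _ _ _ _) j (by simpa using hij))
    · apply oprod_isUnit
      intro m hm
      simp only [Finset.mem_erase, Finset.mem_filter, Finset.mem_univ, true_and] at hm
      exact hunit _ _ hm.2.ne
    · apply oprod_isUnit
      intro m hm
      simp only [Finset.mem_filter, Finset.mem_univ, true_and] at hm
      exact hunit _ _ hm.ne
    · exact oprod_commute _ _ _ fun m _ => hdc _ _ _ _
    · exact oprod_commute _ _ _ fun m _ => hdc _ _ _ _
    · exact oprod_commute _ _ _ fun m _ => (oprod_commute _ _ _ fun m' _ => hdc _ _ _ _).symm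
    · apply oprod_commute
      intro m hm
      simp only [Finset.mem_filter, Finset.mem_univ, true_and] at hm
      exact hzd _ _ _ hij.ne' (hij.trans hm).ne'
    · apply oprod_commute
      intro m hm
      simp only [Finset.mem_erase, Finset.mem_filter, Finset.mem_univ, true_and] at hm
      exact hzd _ _ _ hij.ne hm.1
    · exact hZ' i j hij.ne
  have hc : ∀ i j, i < j →
      (Z i * Z j = (h i - h j - 1) * Ring.inverse (h i - h j) * (Z j * Z i) ↔
       (Z i * oprod (Finset.univ.filter fun m => m < i) (fun m => h i - h m)) *
              (Z j * oprod (Finset.univ.filter fun m => m < j) (fun m => h j - h m)) =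
              (Z j * oprod (Finset.univ.filter fun m => m < j) (fun m => h j - h m)) *
              (Z i * oprod (Finset.univ.filter fun m => m < i) (fun m => h i - h m))) := by
    intro i j hij
    rw [hinv i j hij, ← neg_sub (h j) (h i)]
    symm
    apply core_c (hq := oprod_split (Finset.univ.filter fun m => m < j) (fun m => h j - h m) (fun a b => hdc _ _ _ _) i (by simpa using hij))
    · apply oprod_isUnit
      intro m hm
      simp only [Finset.mem_erase, Finset.mem_filter, Finset.mem_univ, true_and] at hm
      exact hunit _ _ hm.2.ne'
    · apply oprod_isUnit
      intro m hm
      simp only [Finset.mem_filter, Finset.mem_univ, true_and] at hm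
      exact hunit _ _ hm.ne'
    · exact (oprod_commute _ _ _ fun m _ => hdc _ _ _ _).symm
    · exact oprod_commute _ _ _ fun m _ => (oprod_commute _ _ _ fun m' _ => hdc _ _ _ _).symm
    · apply oprod_commute
      intro m hm
      simp only [Finset.mem_filter, Finset.mem_univ, true_and] at hm
      exact hzd _ _ _ hij.ne (hm.trans hij).ne
    · apply oprod_commute
      intro m hm
      simp only [Finset.mem_erase, Finset.mem_filter, Finset.mem_univ, true_and] at hm
      exact hzd _ _ _ hij.ne' hm.1
    · exact hZ2 i j hij.ne
    · exact hv i j hij.ne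
    · have := (hv j i hij.ne').neg_left
      rwa [neg_sub] at this
  refine ⟨⟨fun H i j => ?_, fun H i j hij => (hb i j hij).2 (H i j)⟩,
    ⟨fun H i j => ?_, fun H i j hij => (hc i j hij).2 (H i j)⟩⟩
  · rcases lt_trichotomy i j with hij | rfl | hij
    · exact (hb i j hij).1 (H i j hij)
    · rfl
    · exact ((hb j i hij).1 (H j i hij)).symm
  · rcases lt_trichotomy i j with hij | rfl | hij
    · exact (hc i j hij).1 (H i j hij)
    · rfl
    · exact ((hc j i hij).1 (H j i hij)).symm
end

section
/- Set h̃_i = ℋ_i, Z^i = X^i (Ψ'_i)^{−1}, ∂_i = Υ_i Ψ_i^{−1} (X^i)^{−1}, and Γ_i = ∂_i Z^i. Then for each k = 1, …, n one has Σ_{j=1}^n (∂e_k/∂h̃_j) Γ_j − e_k = a_k, where e_k is the k-th elementary symmetric polynomial evaluated at ℋ_1, …, ℋ_n and ∂e_k/∂h̃_j is the elementary symmetric polynomial e_{k−1} evaluated at the n−1 elements ℋ_l, l ≠ j. (That is, the isomorphism μ sends the indeterminate a_k to the central element c_k of Diff_h(n).) -/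
open Finset

open Polynomial in
lemma comm_core {R : Type*} [CommRing R] {n : ℕ} (h a c : Fin n → R)
    (hu : ∀ i j, i ≠ j → IsUnit (h i - h j))
    (hc : ∀ j, c j * ∏ l ∈ Finset.univ.erase j, (h j - h l) =
      h j ^ n + ∑ K : Fin n, (-1 : R) ^ (K : ℕ) * a K * h j ^ (n - 1 - (K : ℕ)))
    (K : ℕ) (hK1 : 1 ≤ K) (hK2 : K ≤ n) (hlt : K - 1 < n) :
    (∑ j, (∑ s ∈ (Finset.univ.erase j).powersetCard (K - 1), ∏ i ∈ s, h i) * c j) -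
      (∑ s ∈ Finset.univ.powersetCard K, ∏ i ∈ s, h i) = a ⟨K - 1, hlt⟩ := by
  classical
  rcases subsingleton_or_nontrivial R with hR | hR
  · exact Subsingleton.elim _ _
  have coef : ∀ (s : Finset (Fin n)) (m : ℕ), m ≤ s.card →
      (∏ l ∈ s, ((X : R[X]) - C (h l))).coeff (s.card - m) =
        (-1) ^ m * ∑ t ∈ s.powersetCard m, ∏ i ∈ t, h i := by
    intro s m hm
    have := Multiset.prod_X_sub_C_coeff (s.val.map h) (k := s.card - m) (by simp)
    rw [Finset.esymm_map_val] at this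
    simp only [Multiset.map_map, Multiset.card_map, Finset.card_val] at this
    rw [Nat.sub_sub_self hm] at this
    exact this
  set P : R[X] := ∏ l, (X - C (h l)) with hP
  have hPm : P.Monic := monic_prod_of_monic _ _ fun i _ => monic_X_sub_C _
  have hPd : P.natDegree = n := by
    rw [hP, natDegree_prod_of_monic _ _ fun i _ => monic_X_sub_C _]; simp
  set T : R[X] := ∑ K : Fin n, C ((-1 : R) ^ (K : ℕ) * a K) * X ^ (n - 1 - (K : ℕ)) with hT
  set S : R[X] := ∑ j, C (c j) * ∏ l ∈ Finset.univ.erase j, (X - C (h l)) with hS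
  have hTd : T.degree < n := by
    refine (Polynomial.degree_sum_le _ _).trans_lt ?_
    refine (Finset.sup_lt_iff (WithBot.bot_lt_coe n)).2 ?_
    intro b _
    refine (degree_C_mul_X_pow_le _ _).trans_lt ?_
    have := b.2
    exact WithBot.coe_lt_coe.2 (by omega : n - 1 - (b : ℕ) < n)
  have hSd : S.degree < n := by
    refine (Polynomial.degree_sum_le _ _).trans_lt ?_
    refine (Finset.sup_lt_iff (WithBot.bot_lt_coe n)).2 ?_
    intro b _
    refine degree_le_natDegree.trans_lt (WithBot.coe_lt_coe.2 ?_)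
    refine (natDegree_C_mul_le _ _).trans_lt ?_
    rw [natDegree_prod_of_monic _ _ fun i _ => monic_X_sub_C _]
    have := b.2
    simp
    omega
  have hXPd : ((X : R[X]) ^ n - P).degree < n := by
    have hPd' : P.degree = n := by rw [degree_eq_natDegree hPm.ne_zero, hPd]
    have := degree_sub_lt (p := (X : R[X]) ^ n) (q := P) (by rw [degree_X_pow, hPd'])
      (monic_X_pow n).ne_zero (by rw [(monic_X_pow n).leadingCoeff, hPm.leadingCoeff])
    rwa [degree_X_pow] at this
  have hQ : X ^ n - P + T - S = 0 := by
    by_contra hne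
    have hd : (X ^ n - P + T - S).degree < P.degree := by
      rw [degree_eq_natDegree hPm.ne_zero, hPd]
      exact (degree_sub_le _ _).trans_lt
        (max_lt ((degree_add_le _ _).trans_lt (max_lt hXPd hTd)) hSd)
    refine hPm.not_dvd_of_degree_lt hne hd ?_
    refine Finset.prod_dvd_of_coprime ?_ ?_
    · intro i _ j _ hij
      exact isCoprime_X_sub_C_of_isUnit_sub (hu i j hij)
    · intro i _
      rw [dvd_iff_isRoot, IsRoot.def]
      have e1 : eval (h i) P = 0 := by
        rw [hP, eval_prod]
        exact Finset.prod_eq_zero (Finset.mem_univ i) (by simp)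
      have e2 : eval (h i) S = c i * ∏ l ∈ Finset.univ.erase i, (h i - h l) := by
        rw [hS, eval_finset_sum, Finset.sum_eq_single i]
        · simp [eval_prod]
        · intro b _ hb
          rw [eval_mul, eval_prod, Finset.prod_eq_zero (i := i)]
          · simp
          · simp [hb.symm]
          · simp
        · simp
      have e3 : eval (h i) T = ∑ K : Fin n, (-1 : R) ^ (K : ℕ) * a K * h i ^ (n - 1 - (K : ℕ)) := by
        rw [hT, eval_finset_sum]
        simp
      rw [eval_sub, eval_add, eval_sub, e1, e2, e3, hc i]
      simp
  have hco := congrArg (fun q => coeff q (n - K)) hQ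
  simp only [coeff_sub, coeff_add, coeff_zero] at hco
  have c1 : (X ^ n : R[X]).coeff (n - K) = 0 := by
    rw [coeff_X_pow, if_neg (by omega)]
  have c2 : P.coeff (n - K) = (-1) ^ K * ∑ s ∈ Finset.univ.powersetCard K, ∏ i ∈ s, h i := by
    have := coef Finset.univ K (by simpa using hK2)
    simpa using this
  have c3 : T.coeff (n - K) = (-1) ^ (K - 1) * a ⟨K - 1, hlt⟩ := by
    rw [hT, finset_sum_coeff, Finset.sum_eq_single ⟨K - 1, hlt⟩]
    · rw [coeff_C_mul, coeff_X_pow, if_pos (by simp; omega)]; simp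
    · intro b _ hb
      rw [coeff_C_mul, coeff_X_pow, if_neg, mul_zero]
      intro h'
      apply hb
      have := b.2
      ext
      simp
      omega
    · simp
  have c4 : S.coeff (n - K) = (-1) ^ (K - 1) *
      (∑ j, (∑ s ∈ (Finset.univ.erase j).powersetCard (K - 1), ∏ i ∈ s, h i) * c j) := by
    rw [hS, finset_sum_coeff, Finset.mul_sum]
    refine Finset.sum_congr rfl fun j _ => ?_
    have h1 := coef (Finset.univ.erase j) (K - 1) (by simp; omega)
    have h2 : (Finset.univ.erase j).card - (K - 1) = n - K := by simp; omega
    rw [h2] at h1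
    rw [coeff_C_mul, h1]
    ring
  rw [c1, c2, c3, c4] at hco
  obtain ⟨L, rfl⟩ : ∃ L, K = L + 1 := ⟨K - 1, by omega⟩
  simp only [Nat.add_sub_cancel] at hco ⊢
  have hs : ((-1 : R) ^ L) * (-1) ^ L = 1 := by rw [← mul_pow]; simp
  rw [pow_succ] at hco
  linear_combination (-(-1 : R) ^ L) * hco + ((∑ s ∈ Finset.univ.powersetCard (L + 1), ∏ i ∈ s, h i)
    + a ⟨L, by omega⟩ - (∑ j, (∑ s ∈ (Finset.univ.erase j).powersetCard L, ∏ i ∈ s, h i) * c j)) * hs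

lemma oprod_eq_prod {A : Type*} [CommMonoid A] {n : ℕ} (s : Finset (Fin n)) (f : Fin n → A) :
    oprod s f = ∏ i ∈ s, f i := by
  unfold oprod
  rw [Finset.prod_eq_multiset_prod, ← Multiset.prod_coe, ← Multiset.map_coe, Finset.sort_eq]

lemma oprod_map {A A' : Type*} [Monoid A] [Monoid A'] {n : ℕ} (φ : A →* A') (s : Finset (Fin n))
    (f : Fin n → A) : oprod s (fun i => φ (f i)) = φ (oprod s f) := by
  unfold oprod
  rw [map_list_prod, List.map_map]; rfl

lemma exists_comm_subring {B ι : Type*} [Ring B] (f : ι → B) (hf : ∀ i j, f i * f j = f j * f i) :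
    ∃ S : Subring B, (∀ x ∈ S, ∀ y ∈ S, x * y = y * x) ∧ (∀ i, f i ∈ S) ∧
      ∀ x ∈ S, ∀ y, x * y = 1 → y * x = 1 → y ∈ S := by
  have hsub : ∀ x, x ∈ Set.range f → x ∈ Subring.centralizer (Set.range f) := by
    rintro _ ⟨i, rfl⟩
    rw [Subring.mem_centralizer_iff]
    rintro _ ⟨j, rfl⟩
    exact hf j i
  refine ⟨Subring.centralizer (Subring.centralizer (Set.range f) : Set B), ?_, ?_, ?_⟩
  · intro x hx y hy
    rw [Subring.mem_centralizer_iff] at hx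
    refine (hx y ?_).symm
    rw [SetLike.mem_coe, Subring.mem_centralizer_iff]
    intro g hg
    exact (Subring.mem_centralizer_iff.1 hy) g (hsub g hg)
  · intro i
    rw [Subring.mem_centralizer_iff]
    intro g hg
    exact ((Subring.mem_centralizer_iff.1 hg) (f i) ⟨i, rfl⟩).symm
  · intro x hx y h1 h2
    rw [Subring.mem_centralizer_iff] at hx ⊢
    intro g hg
    calc g * y = y * x * (g * y) := by rw [h2, one_mul]
      _ = y * (x * g) * y := by simp only [mul_assoc]
      _ = y * g * (x * y) := by rw [← hx g hg]; simp only [mul_assoc]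
      _ = y * g := by rw [h1, mul_one]

lemma core_B {R B : Type*} [CommRing R] [Ring B] (φ : R →+* B) (hinj : Function.Injective φ)
    (hunit : ∀ x, IsUnit (φ x) → IsUnit x) {n : ℕ} (h a : Fin n → R) (X : Fin n → B)
    (hX : ∀ i, IsUnit (X i))
    (hu : ∀ i j, i ≠ j → IsUnit (φ (h i) - φ (h j))) (K : ℕ) (hK1 : 1 ≤ K) (hK2 : K ≤ n) (hlt : K - 1 < n) :
    (∑ j, (∑ s ∈ (Finset.univ.erase j).powersetCard (K - 1), oprod s (fun i => φ (h i))) *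
      (((φ (h j) ^ n + ∑ K : Fin n, (-1 : B) ^ (K : ℕ) * φ (a K) * φ (h j) ^ (n - 1 - (K : ℕ))) *
            Ring.inverse (oprod (Finset.univ.filter fun m => j < m) (fun m => φ (h j) - φ (h m))) *
            Ring.inverse (X j)) * (X j * Ring.inverse
            (oprod (Finset.univ.filter fun m => m < j) (fun m => φ (h j) - φ (h m)))))) -
      (∑ s ∈ Finset.univ.powersetCard K, oprod s (fun i => φ (h i))) =
        φ (a ⟨K - 1, hlt⟩) := by
  classical
  have hu' : ∀ i j, i ≠ j → IsUnit (h i - h j) := fun i j hij =>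
    hunit _ (by rw [map_sub]; exact hu i j hij)
  have op : ∀ s (f : Fin n → R), oprod s (fun i => φ (f i)) = φ (∏ i ∈ s, f i) := by
    intro s f
    rw [← oprod_eq_prod]
    exact oprod_map (φ : R →* B) s f
  have hinv : ∀ x, IsUnit x → Ring.inverse (φ x) = φ (Ring.inverse x) := by
    intro x hx
    have h1 : Ring.inverse (φ x) * φ x = 1 := Ring.inverse_mul_cancel _ (hx.map φ)
    have h2 : φ x * φ (Ring.inverse x) = 1 := by
      rw [← map_mul, Ring.mul_inverse_cancel _ hx, map_one]
    exact left_inv_eq_right_inv h1 h2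
  have uprod : ∀ (j : Fin n) (s : Finset (Fin n)), j ∉ s → IsUnit (∏ m ∈ s, (h j - h m)) := by
    intro j s hj
    rw [IsUnit.prod_iff]
    intro m hm
    exact hu' j m (by rintro rfl; exact hj hm)
  let c : Fin n → R := fun j =>
    (h j ^ n + ∑ K : Fin n, (-1 : R) ^ (K : ℕ) * a K * h j ^ (n - 1 - (K : ℕ))) *
      Ring.inverse (∏ m ∈ Finset.univ.filter (fun m => j < m), (h j - h m)) *
      Ring.inverse (∏ m ∈ Finset.univ.filter (fun m => m < j), (h j - h m))
  have hc : ∀ j, c j * ∏ l ∈ Finset.univ.erase j, (h j - h l) =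
      h j ^ n + ∑ K : Fin n, (-1 : R) ^ (K : ℕ) * a K * h j ^ (n - 1 - (K : ℕ)) := by
    intro j
    have hsplit : ∏ l ∈ Finset.univ.erase j, (h j - h l) =
        (∏ m ∈ Finset.univ.filter (fun m => j < m), (h j - h m)) *
        (∏ m ∈ Finset.univ.filter (fun m => m < j), (h j - h m)) := by
      rw [← Finset.prod_union]
      · congr 1
        ext m
        simp only [Finset.mem_erase, Finset.mem_univ, Finset.mem_union, Finset.mem_filter]
        grind
      · rw [Finset.disjoint_filter]
        intro m _ h1 h2
        exact lt_asymm h1 h2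
    rw [hsplit]
    have i1 := Ring.inverse_mul_cancel _ (uprod j (Finset.univ.filter (fun m => j < m)) (by simp))
    have i2 := Ring.inverse_mul_cancel _ (uprod j (Finset.univ.filter (fun m => m < j)) (by simp))
    simp only [c]
    generalize h j ^ n + ∑ K : Fin n, (-1 : R) ^ (K : ℕ) * a K * h j ^ (n - 1 - (K : ℕ)) = U
    calc _ = U * (Ring.inverse (∏ m ∈ Finset.univ.filter (fun m => j < m), (h j - h m)) *
            ∏ m ∈ Finset.univ.filter (fun m => j < m), (h j - h m)) *
          (Ring.inverse (∏ m ∈ Finset.univ.filter (fun m => m < j), (h j - h m)) *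
            ∏ m ∈ Finset.univ.filter (fun m => m < j), (h j - h m)) := by ring
      _ = U := by rw [i1, i2, mul_one, mul_one]
  rw [← comm_core h a c hu' hc K hK1 hK2 hlt]
  simp only [map_sub, map_sum, map_mul, op]
  congr 1
  refine Finset.sum_congr rfl fun j _ => ?_
  congr 1
  simp only [← map_sub, op]
  rw [hinv _ (uprod j _ (by simp)), hinv _ (uprod j _ (by simp))]
  simp only [c, map_mul, map_add, map_sum, map_pow, map_neg, map_one]
  simp only [mul_assoc]
  rw [← mul_assoc (Ring.inverse (X j)), Ring.inverse_mul_cancel _ (hX j), one_mul]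

/-- The isomorphism `μ` of Herlemont–Ogievetsky sends the indeterminate `a_k` to the central
element `c_k` of `Diff_h(n)`: with `h̃_i = ℋ_i = D_i X^i`, `Z^i = X^i (Ψ'_i)⁻¹`,
`∂_i = Υ_i Ψ_i⁻¹ (X^i)⁻¹` and `Γ_i = ∂_i Z^i`, one has
`Σ_j (∂e_k/∂h̃_j) Γ_j − e_k = a_k` for `k = 1, …, n`. -/
theorem stmt10 {k B : Type*} [Field k] [CharZero k] [Ring B] [Algebra k B]
    {n : ℕ} (hn : 1 ≤ n) (X D a : Fin n → B)
    (hXX : ∀ i j, X i * X j = X j * X i)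
    (hDD : ∀ i j, D i * D j = D j * D i)
    (hDX : ∀ i j, D i * X j - X j * D i = if i = j then (1 : B) else 0)
    (hXunit : ∀ i, IsUnit (X i))
    (hHunit : ∀ (i j : Fin n) (m : ℤ), i ≠ j → IsUnit (D i * X i - (D j * X j) + (m : B)))
    (hacen : ∀ (i : Fin n) (b : B), a i * b = b * a i) :
    ∀ hw Zd Dd : Fin n → B,
      hw = (fun i => D i * X i) →
      Zd = (fun i => X i * Ring.inverse
            (oprod (Finset.univ.filter fun m => m < i) (fun m => hw i - hw m))) →
      Dd = (fun i => (hw i ^ n + ∑ K : Fin n, (-1 : B) ^ (K : ℕ) * a K * hw i ^ (n - 1 - (K : ℕ))) *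
            Ring.inverse (oprod (Finset.univ.filter fun m => i < m) (fun m => hw i - hw m)) *
            Ring.inverse (X i)) →
      ∀ (K : ℕ) (hK1 : 1 ≤ K) (hK2 : K ≤ n),
        (∑ j, (∑ s ∈ (Finset.univ.erase j).powersetCard (K - 1), oprod s hw) * (Dd j * Zd j)) -
          (∑ s ∈ Finset.univ.powersetCard K, oprod s hw) = a ⟨K - 1, by omega⟩ := by
  intro hw Zd Dd hhw hZ hD K hK1 hK2
  have hcomm : ∀ i j, hw i * hw j = hw j * hw i := by
    intro i j
    by_cases hij : i = j
    · rw [hij]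
    have c1 : Commute (D i) (X j) := by
      have := hDX i j
      rw [if_neg hij] at this
      exact sub_eq_zero.1 this
    have c2 : Commute (D j) (X i) := by
      have := hDX j i
      rw [if_neg (Ne.symm hij)] at this
      exact sub_eq_zero.1 this
    have c3 : Commute (D i) (D j) := hDD i j
    have c4 : Commute (X i) (X j) := hXX i j
    rw [hhw]
    exact ((c3.mul_right c1).mul_left (c2.symm.mul_right c4)).eq
  obtain ⟨S, hSc, hSm, hSi⟩ := exists_comm_subring (Sum.elim hw a) (by
    rintro (i | i) (j | j)
    · exact hcomm i j
    · exact (hacen j _).symm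
    · exact hacen i _
    · exact hacen i _)
  letI : CommRing S := { (inferInstance : Ring S) with
    mul_comm := fun x y => Subtype.ext (hSc x x.2 y y.2) }
  have key := core_B (R := S) S.subtype Subtype.val_injective (by
      rintro x ⟨u, hux⟩
      have e1 : (x : B) * (↑u⁻¹ : B) = 1 := by
        rw [show (x : B) = u from hux.symm, Units.mul_inv]
      have e2 : (↑u⁻¹ : B) * (x : B) = 1 := by
        rw [show (x : B) = u from hux.symm, Units.inv_mul]
      exact ⟨⟨x, ⟨_, hSi x x.2 _ e1 e2⟩, Subtype.ext e1, Subtype.ext e2⟩, rfl⟩)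
    (fun i => ⟨hw i, hSm (Sum.inl i)⟩) (fun i => ⟨a i, hSm (Sum.inr i)⟩) X hXunit (by
      intro i j hij
      have := hHunit i j 0 hij
      simpa [hhw] using this) K hK1 hK2 (by omega)
  rw [hZ, hD]
  exact key
end
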